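/- For any continuous map f : S² → ℝ², the set {x ∈ S² | f(x) = f(-x)} is nonempty and closed, hence compact. -/

import Mathlib

noncomputable abbrev S2 := Metric.sphere (0 : EuclideanSpace ℝ (Fin 3)) 1

open Complex in
/-- A continuous map from the plane to the punctured plane that is odd on the unit circle does not
exist. -/
theorem exists_eq_zero_of_odd_on_circle (g : ℂ → ℂ) (hg : Continuous g)
    (hodd : ∀ z : ℂ, ‖z‖ = 1 → g (-z) = -g z) : ∃ z, g z = 0 := by
  by_contra! h0
  obtain ⟨L, ⟨-, hL⟩, -⟩ := isCoveringMapOn_exp.existsUnique_continuousMap_lifts ⟨g, hg⟩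
    (a₀ := 0) (e₀ := log (g 0)) (exp_log (h0 0)) (fun z => h0 z)
  have hL (z : ℂ) : exp (L z) = g z := congrFun hL z
  let u : ℝ → ℝ := fun t => (L (-exp (t * I)) - L (exp (t * I))).im
  have hu : Continuous u := by fun_prop
  have hπ : u Real.pi = -u 0 := by simp [u, exp_pi_mul_I]
  obtain ⟨t, ht⟩ : (0 : ℝ) ∈ Set.range u := by
    rcases le_total (u 0) 0 with h | h
    · exact mem_range_of_exists_le_of_exists_ge hu ⟨0, h⟩ ⟨Real.pi, by linarith⟩
    · exact mem_range_of_exists_le_of_exists_ge hu ⟨Real.pi, by linarith⟩ ⟨0, h⟩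
  have hexp : exp (L (-exp (t * I)) - L (exp (t * I))) = -1 := by
    rw [exp_sub, hL, hL, hodd _ (norm_exp_ofReal_mul_I t), neg_div, div_self (h0 _)]
  have hre := congrArg re hexp
  rw [exp_re, show (L (-exp (t * I)) - L (exp (t * I))).im = 0 from ht] at hre
  simp only [Real.cos_zero, mul_one, neg_re, one_re] at hre
  linarith [Real.exp_pos (L (-exp (t * I)) - L (exp (t * I))).re]

/-- The inverse stereographic projection from the south pole, sending the unit circle to the
equator. -/
noncomputable def planeToSphere (z : ℂ) : S2 :=
  ⟨!₂[2 * z.re / (1 + ‖z‖ ^ 2), 2 * z.im / (1 + ‖z‖ ^ 2), (1 - ‖z‖ ^ 2) / (1 + ‖z‖ ^ 2)], by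
    have h : (1 + ‖z‖ ^ 2) ≠ 0 := by positivity
    rw [mem_sphere_zero_iff_norm, EuclideanSpace.norm_eq, Real.sqrt_eq_one]
    simp only [Fin.sum_univ_three, Real.norm_eq_abs, sq_abs]
    simp only [Matrix.cons_val]
    field_simp
    rw [Complex.sq_norm, Complex.normSq_apply]
    ring⟩

theorem continuous_planeToSphere : Continuous planeToSphere := by
  have h (z : ℂ) : (1 + ‖z‖ ^ 2) ≠ 0 := by positivity
  refine Continuous.subtype_mk ((PiLp.continuous_toLp 2 _).comp (continuous_pi fun i => ?_)) _
  fin_cases i <;> simp <;> fun_prop (disch := exact h)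

theorem planeToSphere_neg {z : ℂ} (hz : ‖z‖ = 1) : planeToSphere (-z) = -planeToSphere z := by
  ext i
  fin_cases i <;> simp [planeToSphere, hz, neg_div]

/-- The Borsuk–Ulam theorem in dimension two. -/
theorem exists_eq_antipode (f : S2 → EuclideanSpace ℝ (Fin 2)) (hf : Continuous f) :
    ∃ x, f x = f (-x) := by
  let e := Complex.orthonormalBasisOneI.repr.symm
  obtain ⟨z, hz⟩ := exists_eq_zero_of_odd_on_circle
    (fun z => e (f (planeToSphere z) - f (-planeToSphere z)))
    (by have := continuous_planeToSphere; fun_prop)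
    (fun z hz => by rw [planeToSphere_neg hz, neg_neg, ← map_neg, neg_sub])
  exact ⟨planeToSphere z, by simpa [sub_eq_zero] using hz⟩

theorem coincidence_set_nonempty_closed_compact (f : S2 → EuclideanSpace ℝ (Fin 2))
    (hf : Continuous f) :
    ({x : S2 | f x = f (-x)}).Nonempty ∧ IsClosed {x : S2 | f x = f (-x)} ∧
      IsCompact {x : S2 | f x = f (-x)} := by
  have hclosed : IsClosed {x : S2 | f x = f (-x)} := isClosed_eq hf (hf.comp continuous_neg)
  exact ⟨exists_eq_antipode f hf, hclosed, hclosed.isCompact⟩
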